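/- arXiv:0804.4735 — 3 statements merged into one kernel-verified Lean document; each statement's English description precedes it below -/
import Mathlib

section
/- Let m be a positive integer and let G(m) = {u ∈ (ℤ/2mℤ)^× : u₀² ≡ 1 mod 4m for an integer representative u₀}. If m = 1 then G(m) is the trivial group, and if m ≥ 2 then G(m) is isomorphic to (ℤ/2ℤ)^{ω(m)}, where ω(m) denotes the number of distinct prime factors of m; in particular #G(m) = 2^{ω(m)} for m ≥ 2. -/
private lemma sq_cong (m x y : ℤ) (h : 2 * m ∣ x - y) : 4 * m ∣ x ^ 2 - y ^ 2 := by
  obtain ⟨t, ht⟩ := h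
  exact ⟨m * t ^ 2 + t * y, by linear_combination (x + y + 2 * m * t) * ht⟩

private lemma cast_eq_dvd (m : ℕ) (x y : ℤ) (h : (x : ZMod (2 * m)) = (y : ZMod (2 * m))) :
    2 * (m : ℤ) ∣ x - y := by
  have := (ZMod.intCast_eq_intCast_iff x y (2 * m)).mp h
  have hdvd := Int.ModEq.dvd this
  have : ((2 * m : ℕ) : ℤ) ∣ x - y := by
    simpa using (dvd_neg.mpr hdvd)
  simpa using this

/-- The subgroup of `(ℤ/2mℤ)ˣ` consisting of units whose integer representatives
`u₀` satisfy `u₀² ≡ 1 (mod 4m)`. -/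
def unitsRepSq (m : ℕ) : Subgroup (ZMod (2 * m))ˣ where
  carrier := {u | ∀ u₀ : ℤ, (u₀ : ZMod (2 * m)) = (u : ZMod (2 * m)) →
    (4 * (m : ℤ)) ∣ u₀ ^ 2 - 1}
  one_mem' := by
    intro u₀ h
    have h1 : (u₀ : ZMod (2 * m)) = ((1 : ℤ) : ZMod (2 * m)) := by simpa using h
    have := sq_cong m u₀ 1 (cast_eq_dvd m u₀ 1 h1)
    simpa using this
  mul_mem' := by
    intro a b ha hb w₀ hw
    obtain ⟨a₀, ha₀⟩ := ZMod.intCast_surjective (a : ZMod (2 * m))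
    obtain ⟨b₀, hb₀⟩ := ZMod.intCast_surjective (b : ZMod (2 * m))
    obtain ⟨p, hp⟩ := ha a₀ ha₀
    obtain ⟨q, hq⟩ := hb b₀ hb₀
    have hcast : (w₀ : ZMod (2 * m)) = ((a₀ * b₀ : ℤ) : ZMod (2 * m)) := by
      rw [hw]
      push_cast
      rw [ha₀, hb₀]
    obtain ⟨t, ht⟩ := sq_cong m w₀ (a₀ * b₀) (cast_eq_dvd m w₀ (a₀ * b₀) hcast)
    exact ⟨t + p * b₀ ^ 2 + q, by linear_combination ht + b₀ ^ 2 * hp + hq⟩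
  inv_mem' := by
    intro a ha w₀ hw
    obtain ⟨a₀, ha₀⟩ := ZMod.intCast_surjective (a : ZMod (2 * m))
    obtain ⟨p, hp⟩ := ha a₀ ha₀
    have hcast : ((a₀ * w₀ : ℤ) : ZMod (2 * m)) = ((1 : ℤ) : ZMod (2 * m)) := by
      push_cast
      rw [ha₀, hw]
      simp [a.mul_inv]
    obtain ⟨t, ht⟩ := sq_cong m (a₀ * w₀) 1 (cast_eq_dvd m (a₀ * w₀) 1 hcast)
    refine ⟨t - p * w₀ ^ 2, ?_⟩
    linear_combination ht - w₀ ^ 2 * hp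
  -- Note: the goal is `w₀ ^ 2 - 1 = 4 * m * (t - p * w₀ ^ 2)`, and
  -- `(a₀ * w₀)^2 - 1 = (a₀^2 - 1) * w₀^2 + (w₀^2 - 1)`.

private lemma dvd_of_parts (m : ℕ) (hm : 0 < m) (n : ℤ)
    (h : ∀ p ∈ m.primeFactors, ((p ^ m.factorization p : ℕ) : ℤ) ∣ n) : (m : ℤ) ∣ n := by
  have h1 : m = ∏ p ∈ m.primeFactors, p ^ m.factorization p :=
    (Nat.prod_factorization_pow_eq_self hm.ne').symm
  rw [Int.natCast_dvd, h1]
  apply Finset.prod_dvd_of_isRelPrime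
  · intro p hp q hq hpq
    rw [Function.onFun, ← Nat.coprime_iff_isRelPrime]
    exact Nat.Coprime.pow _ _ ((Nat.coprime_primes (Nat.prime_of_mem_primeFactors hp)
      (Nat.prime_of_mem_primeFactors hq)).2 hpq)
  · intro p hp
    exact Int.natCast_dvd.1 (h p hp)

private lemma exists_half (m : ℕ) (u : (ZMod (2 * m))ˣ) (hu : u ∈ unitsRepSq m) :
    ∃ a : ℤ, ((2 * a + 1 : ℤ) : ZMod (2 * m)) = u ∧ (m : ℤ) ∣ a * (a + 1) := by
  obtain ⟨w, hw⟩ := ZMod.intCast_surjective (u : ZMod (2 * m))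
  obtain ⟨t, ht⟩ := hu w hw
  rcases Int.even_or_odd' w with ⟨a, rfl | rfl⟩
  · exfalso
    have : (2 : ℤ) * (2 * (a * a) - 2 * (m * t)) = 1 := by linear_combination ht
    omega
  · exact ⟨a, hw, t, by linarith⟩

private lemma half_cong (m : ℕ) (a b : ℤ)
    (h : ((2 * a + 1 : ℤ) : ZMod (2 * m)) = ((2 * b + 1 : ℤ) : ZMod (2 * m))) :
    (m : ℤ) ∣ a - b := by
  obtain ⟨t, ht⟩ := cast_eq_dvd m _ _ h
  exact ⟨t, by linarith⟩

private lemma half_mem (m : ℕ) (a : ℤ) (h : (m : ℤ) ∣ a * (a + 1)) :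
    ∃ u ∈ unitsRepSq m, ((2 * a + 1 : ℤ) : ZMod (2 * m)) = u := by
  obtain ⟨t, ht⟩ := h
  have hz : ((2 * (m : ℤ) : ℤ) : ZMod (2 * m)) = 0 := by
    have := ZMod.natCast_self (2 * m)
    exact_mod_cast this
  have h1 : ((2 * a + 1 : ℤ) : ZMod (2 * m)) * ((2 * a + 1 : ℤ) : ZMod (2 * m)) = 1 := by
    rw [← Int.cast_mul]
    have : (2 * a + 1) * (2 * a + 1) = (2 * (m : ℤ)) * (2 * t) + 1 := by linear_combination 4 * ht
    rw [this, Int.cast_add, Int.cast_mul, hz]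
    simp
  refine ⟨⟨_, _, h1, h1⟩, ?_, rfl⟩
  intro w hw
  obtain ⟨s, hs⟩ := sq_cong m _ _ (cast_eq_dvd m _ _ hw)
  exact ⟨s + t, by linear_combination hs + 4 * ht⟩

private lemma part_dvd (m p : ℕ) (hp : p ∈ m.primeFactors) (a : ℤ)
    (h : (m : ℤ) ∣ a * (a + 1)) (hpa : (p : ℤ) ∣ a) :
    ((p ^ m.factorization p : ℕ) : ℤ) ∣ a := by
  have hpp := Nat.prime_of_mem_primeFactors hp
  have h1 : ((p ^ m.factorization p : ℕ) : ℤ) ∣ a * (a + 1) :=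
    (Int.natCast_dvd_natCast.2 (Nat.ordProj_dvd m p)).trans h
  refine IsCoprime.dvd_of_dvd_mul_right ?_ h1
  push_cast
  apply IsCoprime.pow_left
  obtain ⟨c, hc⟩ := hpa
  exact ⟨-c, 1, by rw [hc]; ring⟩

private noncomputable def halfRep (m : ℕ) (u : unitsRepSq m) : ℤ :=
  (exists_half m u.1 u.2).choose

private lemma halfRep_cast (m : ℕ) (u : unitsRepSq m) :
    ((2 * halfRep m u + 1 : ℤ) : ZMod (2 * m)) = u.1 :=
  (exists_half m u.1 u.2).choose_spec.1

private lemma halfRep_dvd (m : ℕ) (u : unitsRepSq m) :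
    (m : ℤ) ∣ halfRep m u * (halfRep m u + 1) :=
  (exists_half m u.1 u.2).choose_spec.2

private lemma halfRep_mul (m : ℕ) (u v : unitsRepSq m) :
    (m : ℤ) ∣ halfRep m (u * v) -
      (2 * halfRep m u * halfRep m v + halfRep m u + halfRep m v) := by
  apply half_cong
  rw [halfRep_cast]
  have h1 := halfRep_cast m u
  have h2 := halfRep_cast m v
  rw [Subgroup.coe_mul, Units.val_mul, ← h1, ← h2]
  push_cast
  ring

private lemma primeSign_mul (p : ℕ) (hp : p.Prime) (a b c : ℤ) (ha : (p : ℤ) ∣ a * (a + 1))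
    (hb : (p : ℤ) ∣ b * (b + 1)) (hc : (p : ℤ) ∣ c - (2 * a * b + a + b)) :
    (if (p : ℤ) ∣ c then (0 : ZMod 2) else 1) =
      (if (p : ℤ) ∣ a then (0 : ZMod 2) else 1) + (if (p : ℤ) ∣ b then (0 : ZMod 2) else 1) := by
  have hpi : Prime (p : ℤ) := Nat.prime_iff_prime_int.1 hp
  have hcc : (p : ℤ) ∣ c ↔ (p : ℤ) ∣ 2 * a * b + a + b := (dvd_iff_dvd_of_dvd_sub hc)
  have hnot : ∀ x : ℤ, (p : ℤ) ∣ x → (p : ℤ) ∣ x + 1 → False := fun x h1 h2 =>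
    hpi.not_dvd_one (by simpa using dvd_sub h2 h1)
  rw [if_congr hcc rfl rfl]
  by_cases h1 : (p : ℤ) ∣ a
  · have : (p : ℤ) ∣ 2 * a * b + a + b ↔ (p : ℤ) ∣ b := by
      apply dvd_iff_dvd_of_dvd_sub
      have : 2 * a * b + a + b - b = a * (2 * b + 1) := by ring
      rw [this]
      exact h1.mul_right _
    rw [if_congr this rfl rfl, if_pos h1, zero_add]
  · have h1' := (hpi.dvd_or_dvd ha).resolve_left h1
    by_cases h2 : (p : ℤ) ∣ b
    · have : (p : ℤ) ∣ 2 * a * b + a + b ↔ (p : ℤ) ∣ a := by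
        apply dvd_iff_dvd_of_dvd_sub
        have : 2 * a * b + a + b - a = b * (2 * a + 1) := by ring
        rw [this]
        exact h2.mul_right _
      rw [if_congr this rfl rfl, if_pos h2, add_zero]
    · have h2' := (hpi.dvd_or_dvd hb).resolve_left h2
      have : (p : ℤ) ∣ 2 * a * b + a + b := by
        have : 2 * a * b + a + b = (a + 1) * (2 * b + 1) - (b + 1) := by ring
        rw [this]
        exact dvd_sub (h1'.mul_right _) h2'
      rw [if_pos this, if_neg h1, if_neg h2]
      decide

private noncomputable def primeSignHom (m : ℕ) (e : Fin m.primeFactors.card ≃ m.primeFactors) :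
    unitsRepSq m →* Multiplicative (Fin m.primeFactors.card → ZMod 2) :=
  MonoidHom.mk' (fun u => Multiplicative.ofAdd
    (fun i => if (((e i : ℕ) : ℤ)) ∣ halfRep m u then (0 : ZMod 2) else 1)) (by
    intro u v
    rw [← ofAdd_add]
    congr 1
    funext i
    have hd : ((e i : ℕ) : ℤ) ∣ (m : ℤ) :=
      Int.natCast_dvd_natCast.2 (Nat.dvd_of_mem_primeFactors (e i).2)
    exact primeSign_mul _ (Nat.prime_of_mem_primeFactors (e i).2) _ _ _
      (hd.trans (halfRep_dvd m u)) (hd.trans (halfRep_dvd m v)) (hd.trans (halfRep_mul m u v)))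

private lemma primeSignHom_apply (m : ℕ) (e : Fin m.primeFactors.card ≃ m.primeFactors)
    (u : unitsRepSq m) (i : Fin m.primeFactors.card) :
    Multiplicative.toAdd (primeSignHom m e u) i =
      if (((e i : ℕ) : ℤ)) ∣ halfRep m u then (0 : ZMod 2) else 1 := rfl

private lemma primeSignHom_injective (m : ℕ) (hm : 0 < m)
    (e : Fin m.primeFactors.card ≃ m.primeFactors) : Function.Injective (primeSignHom m e) := by
  rw [injective_iff_map_eq_one]
  intro u hu
  have key : (m : ℤ) ∣ halfRep m u := by
    apply dvd_of_parts m hm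
    intro p hp
    apply part_dvd m p hp _ (halfRep_dvd m u)
    have h1 := primeSignHom_apply m e u (e.symm ⟨p, hp⟩)
    rw [hu, Equiv.apply_symm_apply] at h1
    by_contra hcon
    rw [if_neg hcon] at h1
    exact zero_ne_one h1
  apply Subtype.ext
  apply Units.ext
  rw [← halfRep_cast m u]
  obtain ⟨t, ht⟩ := key
  have hz : ((2 * (m : ℤ) : ℤ) : ZMod (2 * m)) = 0 := by
    have := ZMod.natCast_self (2 * m)
    exact_mod_cast this
  have : 2 * halfRep m u + 1 = (2 * (m : ℤ)) * t + 1 := by rw [ht]; ring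
  rw [this, Int.cast_add, Int.cast_mul, hz]
  simp

private lemma exists_crt (m : ℕ) (hm : 0 < m) (S : ℕ → Prop) :
    ∃ a : ℤ, (m : ℤ) ∣ a * (a + 1) ∧ ∀ p ∈ m.primeFactors, ((p : ℤ) ∣ a ↔ S p) := by
  classical
  obtain ⟨k, hk⟩ := Nat.chineseRemainderOfFinset
    (fun p => if S p then 0 else p ^ m.factorization p - 1)
    (fun p => p ^ m.factorization p) m.primeFactors
    (fun p hp => pow_ne_zero _ (Nat.prime_of_mem_primeFactors hp).ne_zero)
    (fun p hp q hq hpq => Nat.Coprime.pow _ _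
      ((Nat.coprime_primes (Nat.prime_of_mem_primeFactors hp)
        (Nat.prime_of_mem_primeFactors hq)).2 hpq))
  have h0 : ∀ p ∈ m.primeFactors, S p → ((p ^ m.factorization p : ℕ) : ℤ) ∣ (k : ℤ) := by
    intro p hp hS
    have := hk p hp
    simp only [if_pos hS] at this
    exact Int.natCast_dvd_natCast.2 ((Nat.modEq_zero_iff_dvd).1 this)
  have h1 : ∀ p ∈ m.primeFactors, ¬ S p →
      ((p ^ m.factorization p : ℕ) : ℤ) ∣ (k : ℤ) + 1 := by
    intro p hp hS
    have := hk p hp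
    simp only [if_neg hS] at this
    have h2 := this.add_right 1
    rw [Nat.sub_add_cancel (Nat.pos_of_ne_zero
      (pow_ne_zero _ (Nat.prime_of_mem_primeFactors hp).ne_zero))] at h2
    have h3 := (Nat.modEq_zero_iff_dvd).1
      (h2.trans ((Nat.modEq_zero_iff_dvd).2 (dvd_refl _)))
    exact_mod_cast h3
  refine ⟨k, ?_, ?_⟩
  · apply dvd_of_parts m hm
    intro p hp
    by_cases hS : S p
    · exact (h0 p hp hS).mul_right _
    · exact (h1 p hp hS).mul_left _
  · intro p hp
    have hpp := Nat.prime_of_mem_primeFactors hp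
    have hd : (p : ℤ) ∣ ((p ^ m.factorization p : ℕ) : ℤ) :=
      Int.natCast_dvd_natCast.2 (dvd_pow_self p
        (hpp.factorization_pos_of_dvd hm.ne' (Nat.dvd_of_mem_primeFactors hp)).ne')
    constructor
    · intro h
      by_contra hS
      have h2 := dvd_sub (hd.trans (h1 p hp hS)) h
      exact (Nat.prime_iff_prime_int.1 hpp).not_dvd_one (by simpa using h2)
    · intro hS
      exact hd.trans (h0 p hp hS)

private lemma primeSignHom_surjective (m : ℕ) (hm : 0 < m)
    (e : Fin m.primeFactors.card ≃ m.primeFactors) : Function.Surjective (primeSignHom m e) := by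
  intro g
  obtain ⟨a, ha, hS⟩ := exists_crt m hm
    (fun p => ∃ hp : p ∈ m.primeFactors, Multiplicative.toAdd g (e.symm ⟨p, hp⟩) = 0)
  obtain ⟨u, hu, hua⟩ := half_mem m a ha
  refine ⟨⟨u, hu⟩, ?_⟩
  apply Multiplicative.toAdd.injective
  funext i
  rw [primeSignHom_apply]
  have hd : ((e i : ℕ) : ℤ) ∣ (m : ℤ) :=
    Int.natCast_dvd_natCast.2 (Nat.dvd_of_mem_primeFactors (e i).2)
  have h1 : (m : ℤ) ∣ halfRep m ⟨u, hu⟩ - a :=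
    half_cong m _ _ ((halfRep_cast m ⟨u, hu⟩).trans hua.symm)
  have h2 : ((e i : ℕ) : ℤ) ∣ halfRep m ⟨u, hu⟩ ↔ Multiplicative.toAdd g i = 0 := by
    rw [dvd_iff_dvd_of_dvd_sub (hd.trans h1), hS _ (e i).2]
    simp
  rw [if_congr h2 rfl rfl]
  generalize Multiplicative.toAdd g i = x
  revert x
  decide

/-- the group `G(m)` of units of `ℤ/2mℤ` whose integer
representatives `u₀` satisfy `u₀² ≡ 1 (mod 4m)` is trivial for `m = 1`, and for
`m ≥ 2` it is isomorphic to `(ℤ/2ℤ)^{ω(m)}`, where `ω(m)` is the number of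
distinct prime factors of `m`; in particular `#G(m) = 2^{ω(m)}` for `m ≥ 2`. -/
theorem unitsRepSq_structure (m : ℕ) (hm : 0 < m) :
    (m = 1 → unitsRepSq m = ⊥) ∧
    (2 ≤ m →
      Nonempty (unitsRepSq m ≃* Multiplicative (Fin m.primeFactors.card → ZMod 2)) ∧
      Nat.card (unitsRepSq m) = 2 ^ m.primeFactors.card) := by
  have key : Nonempty (unitsRepSq m ≃* Multiplicative (Fin m.primeFactors.card → ZMod 2)) :=
    ⟨MulEquiv.ofBijective (primeSignHom m m.primeFactors.equivFin.symm)
      ⟨primeSignHom_injective m hm _, primeSignHom_surjective m hm _⟩⟩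
  have hcard : Nat.card (unitsRepSq m) = 2 ^ m.primeFactors.card := by
    obtain ⟨f⟩ := key
    rw [Nat.card_congr (f.toEquiv.trans Multiplicative.toAdd)]
    simp
  refine ⟨?_, fun _ => ⟨key, hcard⟩⟩
  rintro rfl
  apply Subgroup.eq_bot_of_card_eq
  simpa using hcard
end

section
/- Let n and d be positive integers with d² dividing n, and let x = (2n/d) mod 2n ∈ D(2n), an isotropic element of order d. Let b(y, z) = y·z/(2n) mod ℤ be the associated bilinear form on ℤ/2nℤ and x^⊥ = {y ∈ ℤ/2nℤ : b(y, x) = 0}. Then ⟨x⟩ ⊆ x^⊥, the quadratic form q descends to a well-defined quadratic form on x^⊥/⟨x⟩, and the resulting finite quadratic module x^⊥/⟨x⟩ is isomorphic to D(2n/d²), i.e. to ℤ/(2n/d²)ℤ with quadratic form y ↦ y²·d²/(2n) mod 2ℤ. -/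
/-- The quadratic form of the discriminant form `D(N)` of a rank-one even lattice:
`q(x) = x² / N ∈ ℚ/2ℤ`, where `ℚ/2ℤ` is modelled as the quotient of `ℚ` by the
subgroup generated by `2`. -/
def discQuad (N : ℕ) (x : ZMod N) : ℚ ⧸ AddSubgroup.zmultiples (2 : ℚ) :=
  QuotientAddGroup.mk ((x.val : ℚ) ^ 2 / (N : ℚ))

/-- The bilinear form `b(y,z) = y·z/N ∈ ℚ/ℤ` associated to `D(N)`, where `ℚ/ℤ`
is modelled as the quotient of `ℚ` by the subgroup generated by `1`. -/
def discBilin (N : ℕ) (y z : ZMod N) : ℚ ⧸ AddSubgroup.zmultiples (1 : ℚ) :=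
  QuotientAddGroup.mk ((y.val : ℚ) * (z.val : ℚ) / (N : ℚ))

lemma aux_val (N : ℕ) (hN : 0 < N) (a : ℤ) :
    ∃ t : ℤ, (((a : ZMod N).val : ℕ) : ℤ) = a + N * t := by
  haveI : NeZero N := ⟨hN.ne'⟩
  have h1 : ((((a : ZMod N).val : ℕ) : ℤ) : ZMod N) = (a : ZMod N) := by
    rw [Int.cast_natCast, ZMod.natCast_zmod_val]
  have h2 := (ZMod.intCast_eq_intCast_iff_dvd_sub _ _ _).1 h1.symm
  obtain ⟨t, ht⟩ := h2
  exact ⟨t, by linarith⟩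

lemma aux_quad (n : ℕ) (hn : 0 < n) (a : ℤ) :
    discQuad (2 * n) (a : ZMod (2 * n)) = QuotientAddGroup.mk ((a : ℚ) ^ 2 / (2 * n)) := by
  obtain ⟨t, ht⟩ := aux_val (2 * n) (by omega) a
  unfold discQuad
  have ht' : (((a : ZMod (2 * n)).val : ℕ) : ℚ) = a + (2 * n) * t := by exact_mod_cast ht
  rw [ht', QuotientAddGroup.eq, AddSubgroup.mem_zmultiples_iff]
  refine ⟨-(a * t + n * t ^ 2), ?_⟩
  have : (n : ℚ) ≠ 0 := by positivity
  push_cast [zsmul_eq_mul]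
  field_simp
  ring

lemma aux_bilin (N : ℕ) (hN : 0 < N) (a b : ℤ) :
    discBilin N (a : ZMod N) (b : ZMod N) = QuotientAddGroup.mk ((a : ℚ) * b / N) := by
  obtain ⟨t, ht⟩ := aux_val N hN a
  obtain ⟨s, hs⟩ := aux_val N hN b
  unfold discBilin
  have ht' : (((a : ZMod N).val : ℕ) : ℚ) = a + N * t := by exact_mod_cast ht
  have hs' : (((b : ZMod N).val : ℕ) : ℚ) = b + N * s := by exact_mod_cast hs
  rw [ht', hs', QuotientAddGroup.eq, AddSubgroup.mem_zmultiples_iff]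
  refine ⟨-(a * s + b * t + N * s * t), ?_⟩
  have : (N : ℚ) ≠ 0 := by positivity
  push_cast [zsmul_eq_mul]
  field_simp
  ring

lemma aux_perp (m d : ℕ) (hm : 0 < m) (hd : 0 < d) (a : ℤ) :
    discBilin (2 * (d ^ 2 * m)) (a : ZMod (2 * (d ^ 2 * m)))
      ((2 * d * m : ℕ) : ZMod (2 * (d ^ 2 * m))) = 0 ↔ (d : ℤ) ∣ a := by
  have h0 := aux_bilin (2 * (d ^ 2 * m)) (by positivity) a ((2 * d * m : ℕ) : ℤ)
  rw [Int.cast_natCast] at h0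
  have hm' : (m : ℚ) ≠ 0 := by positivity
  have hd' : (d : ℚ) ≠ 0 := by positivity
  rw [h0, QuotientAddGroup.eq_zero_iff, AddSubgroup.mem_zmultiples_iff]
  have e : (a : ℚ) * (((2 * d * m : ℕ) : ℤ) : ℚ) / ((2 * (d ^ 2 * m) : ℕ) : ℚ) = a / d := by
    push_cast
    field_simp
  rw [e]
  constructor
  · rintro ⟨k, hk⟩
    refine ⟨k, ?_⟩
    rw [zsmul_eq_mul, mul_one, eq_div_iff hd'] at hk
    have : k * (d : ℤ) = a := by exact_mod_cast hk
    linarith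
  · rintro ⟨k, rfl⟩
    refine ⟨k, ?_⟩
    push_cast [zsmul_eq_mul]
    field_simp

lemma aux_mult (m d : ℕ) (hd : 0 < d) (k : ℤ) :
    (((d * k : ℤ)) : ZMod (2 * (d ^ 2 * m))) ∈
      AddSubgroup.zmultiples ((2 * d * m : ℕ) : ZMod (2 * (d ^ 2 * m))) ↔
      ((2 * m : ℕ) : ℤ) ∣ k := by
  have hd' : (d : ℤ) ≠ 0 := by positivity
  rw [AddSubgroup.mem_zmultiples_iff]
  constructor
  · rintro ⟨j, hj⟩
    have : ((j * (2 * d * m : ℕ) : ℤ) : ZMod (2 * (d ^ 2 * m)))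
        = ((d * k : ℤ) : ZMod (2 * (d ^ 2 * m))) := by
      rw [← hj, zsmul_eq_mul, Int.cast_mul, Int.cast_natCast]
    obtain ⟨t, ht⟩ := (ZMod.intCast_eq_intCast_iff_dvd_sub _ _ _).1 this
    refine ⟨j + d * t, ?_⟩
    apply mul_left_cancel₀ hd'
    push_cast at ht ⊢
    linear_combination ht
  · rintro ⟨j, rfl⟩
    refine ⟨j, ?_⟩
    rw [zsmul_eq_mul]
    push_cast
    ring

lemma aux_phi (m d : ℕ) (hm : 0 < m) (hd : 0 < d) (k : ℤ) :
    (((((d * k : ℤ)) : ZMod (2 * (d ^ 2 * m))).val / d : ℕ) : ZMod (2 * m)) = (k : ZMod (2 * m)) := by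
  obtain ⟨t, ht⟩ := aux_val (2 * (d ^ 2 * m)) (by positivity) (d * k)
  have hd' : (d : ℤ) ≠ 0 := by positivity
  rw [← Int.cast_natCast, Int.natCast_div, ht]
  have : (d * k + ((2 * (d ^ 2 * m) : ℕ) : ℤ) * t) = d * (k + ((2 * m : ℕ) : ℤ) * (d * t)) := by
    push_cast; ring
  rw [this, Int.mul_ediv_cancel_left _ hd', Int.cast_add, Int.cast_mul _ (_ * t), Int.cast_natCast,
    ZMod.natCast_self, zero_mul, add_zero]

/-- for `d² ∣ n` and the order-`d` isotropic element
`x = 2n/d ∈ D(2n)`, we have `⟨x⟩ ⊆ x^⊥`, the quadratic form `q` descends to a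
well-defined quadratic form on `x^⊥/⟨x⟩`, and the resulting finite quadratic
module is isomorphic to `D(2n/d²)`, i.e. `ℤ/(2n/d²)ℤ` with the quadratic form
`y ↦ y²·d²/(2n) mod 2ℤ`. The isomorphism `x^⊥/⟨x⟩ ≅ D(2n/d²)` is expressed by
an additive surjection `φ` on `x^⊥` with kernel `⟨x⟩` matching the quadratic
forms. -/
theorem perp_quotient_iso_disc (n d : ℕ) (hn : 0 < n) (hd : 0 < d) (h : d ^ 2 ∣ n) :
    let x : ZMod (2 * n) := ((2 * n / d : ℕ) : ZMod (2 * n))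
    let perp : Set (ZMod (2 * n)) := {y | discBilin (2 * n) y x = 0}
    -- ⟨x⟩ ⊆ x^⊥
    (∀ y ∈ AddSubgroup.zmultiples x, y ∈ perp) ∧
    -- q descends to a well-defined quadratic form on x^⊥/⟨x⟩
    (∀ y ∈ perp, ∀ z ∈ perp, y - z ∈ AddSubgroup.zmultiples x →
      discQuad (2 * n) y = discQuad (2 * n) z) ∧
    -- the quotient x^⊥/⟨x⟩ with the descended form is isomorphic to D(2n/d²)
    (∃ φ : perp → ZMod (2 * n / d ^ 2),
      (∀ (y z : perp) (hyz : (y : ZMod (2 * n)) + (z : ZMod (2 * n)) ∈ perp),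
        φ ⟨(y : ZMod (2 * n)) + (z : ZMod (2 * n)), hyz⟩ = φ y + φ z) ∧
      Function.Surjective φ ∧
      (∀ y : perp, φ y = 0 ↔ (y : ZMod (2 * n)) ∈ AddSubgroup.zmultiples x) ∧
      (∀ y : perp, discQuad (2 * n) (y : ZMod (2 * n)) =
        QuotientAddGroup.mk ((((φ y).val : ℚ)) ^ 2 * (d : ℚ) ^ 2 / (2 * (n : ℚ))))) := by
  obtain ⟨m, rfl⟩ := h
  have hm : 0 < m := Nat.pos_of_mul_pos_left hn
  have e1 : 2 * (d ^ 2 * m) / d = 2 * d * m :=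
    Nat.div_eq_of_eq_mul_left hd (by ring)
  have e2 : 2 * (d ^ 2 * m) / d ^ 2 = 2 * m :=
    Nat.div_eq_of_eq_mul_left (by positivity) (by ring)
  rw [e1, e2]
  intro x perp
  have key : ∀ y ∈ perp, ∃ k : ℤ, y = ((d * k : ℤ) : ZMod (2 * (d ^ 2 * m))) := by
    intro y hy
    obtain ⟨a, rfl⟩ := ZMod.intCast_surjective y
    obtain ⟨k, rfl⟩ := (aux_perp m d hm hd a).1 hy
    exact ⟨k, rfl⟩
  have mem : ∀ k : ℤ, ((d * k : ℤ) : ZMod (2 * (d ^ 2 * m))) ∈ perp := fun k =>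
    (aux_perp m d hm hd _).2 ⟨k, rfl⟩
  have quad : ∀ k : ℤ, discQuad (2 * (d ^ 2 * m)) ((d * k : ℤ) : ZMod (2 * (d ^ 2 * m)))
      = discQuad (2 * m) (k : ZMod (2 * m)) := by
    intro k
    rw [aux_quad _ hn, aux_quad _ hm]
    congr 1
    have hm' : (m : ℚ) ≠ 0 := by positivity
    have hd' : (d : ℚ) ≠ 0 := by positivity
    push_cast
    field_simp
  refine ⟨?_, ?_, fun y => ((y.1.val / d : ℕ) : ZMod (2 * m)), ?_, ?_, ?_, ?_⟩
  · intro y hy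
    obtain ⟨j, rfl⟩ := AddSubgroup.mem_zmultiples_iff.1 hy
    have := mem (j * (2 * m))
    convert this using 1
    simp only [x, zsmul_eq_mul]
    push_cast
    ring
  · intro y hy z hz hyz
    obtain ⟨k, rfl⟩ := key y hy
    obtain ⟨l, rfl⟩ := key z hz
    rw [← Int.cast_sub, ← mul_sub, aux_mult m d hd] at hyz
    rw [quad, quad, (ZMod.intCast_eq_intCast_iff_dvd_sub l k _).2 hyz]
  · rintro ⟨y, hy⟩ ⟨z, hz⟩ hyz
    obtain ⟨k, rfl⟩ := key y hy
    obtain ⟨l, rfl⟩ := key z hz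
    simp only
    rw [← Int.cast_add, ← mul_add, aux_phi m d hm hd, aux_phi m d hm hd, aux_phi m d hm hd,
      Int.cast_add]
  · intro w
    obtain ⟨k, rfl⟩ := ZMod.intCast_surjective w
    exact ⟨⟨_, mem k⟩, aux_phi m d hm hd k⟩
  · rintro ⟨y, hy⟩
    obtain ⟨k, rfl⟩ := key y hy
    simp only
    rw [aux_phi m d hm hd, aux_mult m d hd, ZMod.intCast_zmod_eq_zero_iff_dvd]
  · rintro ⟨y, hy⟩
    obtain ⟨k, rfl⟩ := key y hy
    simp only
    rw [aux_phi m d hm hd, quad]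
    unfold discQuad
    congr 1
    have hm' : (m : ℚ) ≠ 0 := by positivity
    have hd' : (d : ℚ) ≠ 0 := by positivity
    push_cast
    field_simp
end

section
/- Let M be an even lattice, let L = U ⊕ M be the orthogonal direct sum with the hyperbolic plane U, and let ι: U → L be the inclusion of the first summand. If φ: U → L is an isometric embedding such that the orthogonal complement φ(U)^⊥ in L is isometric to M, then there exists an isometry γ of L with γ ∘ ι = φ. In particular, the isometry group O(L) acts transitively on the set of isometric embeddings of U into L whose orthogonal complement is isometric to M. -/
/-- let `M` be an even lattice and `L = U ⊕ M` the orthogonal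
direct sum with the hyperbolic plane `U` (modelled as `ℤ²` with form
`((a,b),(a',b')) = a·b' + a'·b`), so `L = (ℤ × ℤ) × M` with the form `BL`, and
let `ι : U → L` be the inclusion `u ↦ (u, 0)` of the first summand. If
`φ : U → L` is an isometric embedding whose orthogonal complement `φ(U)^⊥` in
`L` is isometric to `M` (via an embedding `ψ : M → L` with image `φ(U)^⊥`),
then there is an isometry `γ` of `L` with `γ ∘ ι = φ`. -/
theorem transitive_on_hyperbolic_embeddings
    (M : Type*) [AddCommGroup M] [Module ℤ M] [Module.Free ℤ M] [Module.Finite ℤ M]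
    (BM : M →ₗ[ℤ] M →ₗ[ℤ] ℤ)
    (hsymm : ∀ x y : M, BM x y = BM y x)
    (hnd : ∀ x : M, (∀ y : M, BM x y = 0) → x = 0)
    (heven : ∀ x : M, ∃ m : ℤ, BM x x = 2 * m)
    (BL : (ℤ × ℤ) × M → (ℤ × ℤ) × M → ℤ)
    (hBL : ∀ x y : (ℤ × ℤ) × M,
      BL x y = (x.1.1 * y.1.2 + x.1.2 * y.1.1) + BM x.2 y.2)
    (φ : (ℤ × ℤ) →ₗ[ℤ] (ℤ × ℤ) × M)
    (hφinj : Function.Injective φ)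
    (hφiso : ∀ u v : ℤ × ℤ, BL (φ u) (φ v) = u.1 * v.2 + u.2 * v.1)
    (ψ : M →ₗ[ℤ] (ℤ × ℤ) × M)
    (hψinj : Function.Injective ψ)
    (hψrange : ∀ x : (ℤ × ℤ) × M,
      x ∈ Set.range ψ ↔ ∀ u : ℤ × ℤ, BL x (φ u) = 0)
    (hψiso : ∀ a b : M, BL (ψ a) (ψ b) = BM a b) :
    ∃ γ : ((ℤ × ℤ) × M) ≃ₗ[ℤ] ((ℤ × ℤ) × M),
      (∀ x y : (ℤ × ℤ) × M, BL (γ x) (γ y) = BL x y) ∧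
      ∀ u : ℤ × ℤ, γ (u, 0) = φ u := by
  have hadd : ∀ x y z, BL (x + y) z = BL x z + BL y z := by
    intro x y z
    simp only [hBL, Prod.fst_add, Prod.snd_add, map_add, LinearMap.add_apply]
    ring
  have hsub : ∀ x y z, BL (x - y) z = BL x z - BL y z := by
    intro x y z
    simp only [hBL, Prod.fst_sub, Prod.snd_sub, map_sub, LinearMap.sub_apply]
    ring
  have hcomm : ∀ x y, BL x y = BL y x := by
    intro x y
    rw [hBL, hBL, hsymm]
    ring
  have hadd2 : ∀ x y z, BL x (y + z) = BL x y + BL x z := by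
    intro x y z
    rw [hcomm, hadd, hcomm y, hcomm z]
  have hsmul2 : ∀ (c : ℤ) x y, BL x (c • y) = c * BL x y := by
    intro c x y
    simp only [hBL, Prod.smul_fst, Prod.smul_snd, map_zsmul, smul_eq_mul]
    ring
  have horth : ∀ m u, BL (ψ m) (φ u) = 0 := fun m => (hψrange (ψ m)).1 ⟨m, rfl⟩
  have horth2 : ∀ m u, BL (φ u) (ψ m) = 0 := fun m u => by rw [hcomm, horth]
  have hf : ∀ x, (φ.toAddMonoidHom.coprod ψ.toAddMonoidHom) x = φ x.1 + ψ x.2 := fun x => by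
    rfl
  have hdec : ∀ v : ℤ × ℤ, φ v = v.1 • φ (1, 0) + v.2 • φ (0, 1) := by
    intro v
    rw [← map_smul, ← map_smul, ← map_add]
    congr 1
    ext <;> simp
  have hbij : Function.Bijective (φ.toAddMonoidHom.coprod ψ.toAddMonoidHom) := by
    constructor
    · rw [injective_iff_map_eq_zero]
      intro x hx
      rw [hf] at hx
      have key : ∀ v : ℤ × ℤ, x.1.1 * v.2 + x.1.2 * v.1 = 0 := by
        intro v
        have h : BL (φ x.1 + ψ x.2) (φ v) = 0 := by
          rw [hx, hBL]
          simp
        rw [hadd, horth, hφiso] at h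
        linarith
      have h1 := key (0, 1)
      have h2 := key (1, 0)
      simp only [mul_one, mul_zero, add_zero, zero_add] at h1 h2
      have h3 : x.1 = 0 := Prod.ext h1 h2
      rw [h3, map_zero, zero_add] at hx
      exact Prod.ext h3 (hψinj (hx.trans (map_zero ψ).symm))
    · intro y
      obtain ⟨m, hm⟩ := (hψrange (y - φ (BL y (φ (0, 1)), BL y (φ (1, 0))))).2 (by
        intro v
        rw [hsub, hφiso, hdec v, hadd2, hsmul2, hsmul2]
        ring)
      refine ⟨((BL y (φ (0, 1)), BL y (φ (1, 0))), m), ?_⟩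
      rw [hf, hm]
      abel
  refine ⟨(AddEquiv.ofBijective (φ.toAddMonoidHom.coprod ψ.toAddMonoidHom) hbij).toIntLinearEquiv, ?_, ?_⟩
  · intro x y
    change BL (φ x.1 + ψ x.2) (φ y.1 + ψ y.2) = BL x y
    rw [hadd, hadd2, hadd2,
      horth, horth2, hφiso, hψiso, hBL x y]
    ring
  · intro u
    change φ u + ψ 0 = φ u
    rw [map_zero, add_zero]
end
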